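/- There exists a constant C > 0 such that |∂²_x K_1(x,y)|_{x=0}| ≤ C · cos(πy/2) for all y ∈ (-1,1), where ∂²_x denotes the second partial derivative with respect to the first variable. -/

import Mathlib

open Real Set

/-- The Dirichlet heat kernel of the interval `[-1,1]`:
`K t x y = (4πt)^{-1/2} (∑_{k ∈ ℤ} e^{-(x-y+4k)²/(4t)} − ∑_{k ∈ ℤ} e^{-(x+y+4k-2)²/(4t)})`. -/
noncomputable def K (t x y : ℝ) : ℝ :=
  (Real.sqrt (4 * Real.pi * t))⁻¹ *
    ((∑' k : ℤ, Real.exp (-(x - y + 4 * (k : ℝ)) ^ 2 / (4 * t))) -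
     (∑' k : ℤ, Real.exp (-(x + y + 4 * (k : ℝ) - 2) ^ 2 / (4 * t))))

noncomputable def thetaAux (u : ℝ) : ℝ := ∑' k : ℤ, Real.exp (-(u + 4 * (k : ℝ)) ^ 2 / 4)

lemma thetaAux_eq (u : ℝ) : ((thetaAux u : ℝ) : ℂ) =
    Complex.exp (-(u : ℂ) ^ 2 / 4) *
      jacobiTheta₂ (Complex.I * u / Real.pi) (4 * Complex.I / Real.pi) := by
  have hp : (Real.pi : ℂ) ≠ 0 := by exact_mod_cast Real.pi_ne_zero
  unfold thetaAux jacobiTheta₂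
  rw [Complex.ofReal_tsum, ← tsum_mul_left]
  refine tsum_congr fun k => ?_
  unfold jacobiTheta₂_term
  rw [← Complex.exp_add]
  push_cast
  congr 1
  field_simp
  ring_nf
  simp only [Complex.I_sq]
  ring

lemma thetaAux_contDiff : ContDiff ℝ 4 thetaAux := by
  have hF : Differentiable ℂ (fun u : ℂ => Complex.exp (-u ^ 2 / 4) *
      jacobiTheta₂ (Complex.I * u / Real.pi) (4 * Complex.I / Real.pi)) := by
    intro u
    have him : 0 < (4 * Complex.I / (Real.pi : ℂ)).im := by
      rw [Complex.div_ofReal_im]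
      simp [Real.pi_pos]
    refine DifferentiableAt.mul (by fun_prop) ?_
    exact DifferentiableAt.comp u (g := fun z => jacobiTheta₂ z (4 * Complex.I / Real.pi))
      (f := fun u : ℂ => Complex.I * u / Real.pi)
      (differentiableAt_jacobiTheta₂_fst _ him) (by fun_prop)
  have h2 : ContDiff ℝ 4 (fun u : ℂ => Complex.exp (-u ^ 2 / 4) *
      jacobiTheta₂ (Complex.I * u / Real.pi) (4 * Complex.I / Real.pi)) :=
    (hF.contDiff (n := 4)).restrict_scalars ℝ
  have h3 := Complex.reCLM.contDiff.comp (h2.comp Complex.ofRealCLM.contDiff)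
  convert h3 using 1
  funext u
  have := thetaAux_eq u
  simp only [Function.comp, Complex.ofRealCLM_apply, Complex.reCLM_apply]
  rw [← this, Complex.ofReal_re]

lemma thetaAux_periodic (u : ℝ) : thetaAux (u + 4) = thetaAux u := by
  unfold thetaAux
  rw [← (Equiv.addRight (1 : ℤ)).tsum_eq (fun k : ℤ => Real.exp (-(u + 4 * (k : ℝ)) ^ 2 / 4))]
  refine tsum_congr fun k => ?_
  simp only [Equiv.coe_addRight]
  push_cast
  ring_nf

lemma K_eq (x y : ℝ) : K 1 x y =
    (Real.sqrt (4 * Real.pi))⁻¹ * (thetaAux (x - y) - thetaAux (x - (2 - y))) := by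
  unfold K thetaAux
  simp only [mul_one]
  have : ∀ k : ℤ, x + y + 4 * (k : ℝ) - 2 = x - (2 - y) + 4 * (k : ℝ) := fun k => by ring
  simp only [this]

lemma d2K (y : ℝ) : deriv (deriv (fun x => K 1 x y)) 0 =
    (Real.sqrt (4 * Real.pi))⁻¹ *
      (deriv (deriv thetaAux) (-y) - deriv (deriv thetaAux) (y - 2)) := by
  have hd : Differentiable ℝ thetaAux := thetaAux_contDiff.differentiable (by norm_num)
  have hd2 : Differentiable ℝ (deriv thetaAux) :=
    ((contDiff_succ_iff_deriv (n := 3)).1 thetaAux_contDiff).2.2.differentiable (by norm_num)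
  have key : ∀ f : ℝ → ℝ, Differentiable ℝ f → ∀ c x a b : ℝ,
      deriv (fun x => c * (f (x - a) - f (x - b))) x =
        c * (deriv f (x - a) - deriv f (x - b)) := by
    intro f hf c x a b
    have h1 : ∀ a, HasDerivAt (fun x => f (x - a)) (deriv f (x - a)) x := fun a =>
      HasDerivAt.comp_sub_const x a (hf (x - a)).hasDerivAt
    exact (((h1 a).sub (h1 b)).const_mul c).deriv
  simp only [K_eq]
  have e : deriv (fun x => (Real.sqrt (4 * Real.pi))⁻¹ *
      (thetaAux (x - y) - thetaAux (x - (2 - y)))) = fun x => (Real.sqrt (4 * Real.pi))⁻¹ *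
      (deriv thetaAux (x - y) - deriv thetaAux (x - (2 - y))) :=
    funext fun x => key thetaAux hd _ x y (2 - y)
  rw [e, key _ hd2]
  ring_nf

/-- There is a constant `C > 0` such that `|∂²_x K_1(x,y)|_{x=0}| ≤ C cos(πy/2)` for all
`y ∈ (-1,1)`, where `∂²_x` is the second partial derivative in the first variable. -/
theorem heat_kernel_second_derivative_bound :
    ∃ C > (0 : ℝ), ∀ y ∈ Set.Ioo (-1 : ℝ) 1,
      |deriv (deriv (fun x => K 1 x y)) 0| ≤ C * Real.cos (Real.pi * y / 2) := by
  simp only [d2K]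
  have hc1 := ((contDiff_succ_iff_deriv (n := 3)).1 thetaAux_contDiff).2.2
  have hc : ContDiff ℝ 2 (deriv (deriv thetaAux)) :=
    ((contDiff_succ_iff_deriv (n := 2)).1 hc1).2.2
  have hper : ∀ u, deriv (deriv thetaAux) (u + 4) = deriv (deriv thetaAux) u := by
    have step : ∀ f : ℝ → ℝ, (∀ u, f (u + 4) = f u) → ∀ u, deriv f (u + 4) = deriv f u := by
      intro f hf u
      rw [← deriv_comp_add_const, funext hf]
    exact step _ (step _ thetaAux_periodic)
  set h := deriv (deriv thetaAux)
  set c := (Real.sqrt (4 * Real.pi))⁻¹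
  set g : ℝ → ℝ := fun y => c * (h (-y) - h (y - 2)) with hg
  have hgc : ContDiff ℝ 2 g := by
    rw [hg]
    fun_prop
  have hg1 : g 1 = 0 := by simp only [hg]; norm_num
  have hg2 : g (-1) = 0 := by
    have := hper (-3)
    simp only [hg]; norm_num at this ⊢
    rw [this]; simp
  obtain ⟨L, hL⟩ := isCompact_Icc.exists_bound_of_continuousOn (s := Icc (-1 : ℝ) 1)
    (hgc.continuous_deriv (by norm_num)).continuousOn
  have hL0 : 0 ≤ L := (norm_nonneg _).trans (hL 0 (by norm_num))
  have hlip : ∀ x ∈ Icc (-1 : ℝ) 1, ∀ y ∈ Icc (-1 : ℝ) 1, ‖g y - g x‖ ≤ L * ‖y - x‖ :=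
    fun x hx y hy => (convex_Icc (-1 : ℝ) 1).norm_image_sub_le_of_norm_deriv_le
      (fun z _ => (hgc.differentiable (by norm_num)) z) hL hx hy
  refine ⟨L + 1, by linarith, fun y hy => ?_⟩
  have hy' : y ∈ Icc (-1 : ℝ) 1 := ⟨hy.1.le, hy.2.le⟩
  have hgy : |g y| ≤ L * (1 - |y|) := by
    rcases le_total 0 y with h0 | h0
    · have := hlip 1 (by norm_num) y hy'
      rw [hg1, sub_zero, Real.norm_eq_abs, Real.norm_eq_abs,
        abs_of_nonpos (by linarith [hy.2] : y - 1 ≤ 0)] at this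
      rw [abs_of_nonneg h0]; linarith
    · have := hlip (-1) (by norm_num) y hy'
      rw [hg2, sub_zero, Real.norm_eq_abs, Real.norm_eq_abs,
        abs_of_nonneg (by linarith [hy.1] : 0 ≤ y - -1)] at this
      rw [abs_of_nonpos h0]; linarith
  have hay : |y| < 1 := abs_lt.2 hy
  have hcos : 1 - |y| ≤ Real.cos (Real.pi * y / 2) := by
    rw [← Real.cos_abs, abs_div, abs_mul, abs_of_pos Real.pi_pos, abs_two]
    have := Real.one_sub_mul_le_cos (x := Real.pi * |y| / 2) (by positivity)
      (by nlinarith [Real.pi_pos])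
    refine le_trans (le_of_eq ?_) this
    field_simp
  calc |g y| ≤ L * (1 - |y|) := hgy
    _ ≤ (L + 1) * Real.cos (Real.pi * y / 2) := by
      apply mul_le_mul (by linarith) hcos (by linarith) (by linarith)
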